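/- Let R be a commutative noetherian ring whose spectrum is {m, p} with p ⊊ m, m the unique maximal ideal. Let L be a free R-module with completion L̂ and L' = L̂/L. Then L' is naturally an R_p-module, and moreover L' ≅ Ext¹_R(R_p, L) as R-modules. -/

import Mathlib

open CategoryTheory

namespace AdicCompletion

section PrincipalPower

variable {R : Type*} [CommRing R] {I : Ideal R} {L : Type*} [AddCommGroup L] [Module R L]
variable {x : R} {N : ℕ}

theorem exists_eq_smul_of_eval_eq_zero (hI : I.FG) (hN : I ^ N ≤ Ideal.span {x})
    {y : AdicCompletion I L} (hy : eval I L N y = 0) : ∃ z, y = x • z := by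
  have h : y ∈ (I ^ N • ⊤ : Submodule R (AdicCompletion I L)) := by
    rw [pow_smul_top_eq_ker_eval hI]
    exact hy
  have h' := Submodule.smul_mono_left hN h
  rw [Submodule.ideal_span_singleton_smul, Submodule.mem_smul_pointwise_iff_exists] at h'
  obtain ⟨z, -, hz⟩ := h'
  exact ⟨z, hz.symm⟩

theorem exists_eq_of_add_smul (hI : I.FG) (hN : I ^ N ≤ Ideal.span {x})
    (y : AdicCompletion I L) : ∃ a z, y = of I L a + x • z := by
  obtain ⟨a, ha⟩ := Submodule.Quotient.mk_surjective _ (eval I L N y)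
  obtain ⟨z, hz⟩ := exists_eq_smul_of_eval_eq_zero hI hN (y := y - of I L a) (by
    rw [map_sub, ← ha, eval_of]
    exact sub_self _)
  exact ⟨a, z, by rw [← hz]; abel⟩

theorem exists_eq_smul_of_of_eq_smul (hN : I ^ N ≤ Ideal.span {x})
    {a : L} {z : AdicCompletion I L} (h : of I L a = x • z) : ∃ b, a = x • b := by
  obtain ⟨c, hc⟩ := Submodule.Quotient.mk_surjective _ (eval I L N z)
  have h1 : a - x • c ∈ (I ^ N • ⊤ : Submodule R L) := by
    rw [← Submodule.Quotient.mk_eq_zero, Submodule.Quotient.mk_sub, Submodule.Quotient.mk_smul,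
      hc, ← map_smul, ← h, eval_of]
    exact sub_self _
  have h2 := Submodule.smul_mono_left hN h1
  rw [Submodule.ideal_span_singleton_smul, Submodule.mem_smul_pointwise_iff_exists] at h2
  obtain ⟨b, -, hb⟩ := h2
  exact ⟨b + c, by rw [smul_add, hb]; abel⟩

theorem eq_zero_of_forall_eq_pow_smul (hx : x ∈ I) {y : AdicCompletion I L}
    (h : ∀ n, ∃ z, y = x ^ n • z) : y = 0 := by
  ext n
  obtain ⟨z, hz⟩ := h n
  obtain ⟨c, hc⟩ := Submodule.Quotient.mk_surjective _ (eval I L n z)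
  have : eval I L n y = 0 := by
    rw [hz, map_smul, ← hc, ← Submodule.Quotient.mk_smul, Submodule.Quotient.mk_eq_zero]
    exact Submodule.smul_mem_smul (Ideal.pow_mem_pow hx n) trivial
  simpa using this

theorem pow_mul_le_span_pow (hN : I ^ N ≤ Ideal.span {x}) (k : ℕ) :
    I ^ (N * k) ≤ Ideal.span {x ^ k} := by
  rw [pow_mul, ← Ideal.span_singleton_pow]
  exact Ideal.pow_right_mono hN k

/-- If the `x`-power torsion of `L` is bounded, then `x` acts injectively on `L̂ / L`. -/
theorem mem_range_of_of_smul_mem (hI : I.FG) (hx : x ∈ I) (hN : I ^ N ≤ Ideal.span {x}) {M : ℕ}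
    (hM : ∀ z : L, x ^ (M + 1) • z = 0 → x ^ M • z = 0) [IsHausdorff I L]
    {y : AdicCompletion I L} (hy : x • y ∈ LinearMap.range (of I L)) :
    y ∈ LinearMap.range (of I L) := by
  have hinj := of_injective I L
  obtain ⟨l, hl⟩ := hy
  obtain ⟨b, rfl⟩ := exists_eq_smul_of_of_eq_smul hN hl
  obtain ⟨y', rfl⟩ : ∃ y', y = y' + of I L b := ⟨y - of I L b, by abel⟩
  have hy' : x • y' = 0 := by
    rw [map_smul, smul_add] at hl
    simpa using hl
  have key : ∀ n, ∃ t z, x • t = 0 ∧ y' = of I L t + x ^ n • z := by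
    intro n
    obtain ⟨a, z, ha⟩ := exists_eq_of_add_smul hI (pow_mul_le_span_pow hN n) y'
    have h1 : of I L (x • a) = x ^ (n + 1) • (-z) := by
      rw [ha, smul_add, smul_smul, ← pow_succ'] at hy'
      rw [map_smul, smul_neg]
      exact eq_neg_of_add_eq_zero_left hy'
    obtain ⟨w, hw⟩ := exists_eq_smul_of_of_eq_smul (pow_mul_le_span_pow hN (n + 1)) h1
    refine ⟨a - x ^ n • w, z + of I L w, ?_, ?_⟩
    · rw [smul_sub, hw, smul_smul, pow_succ', sub_self]
    · rw [ha, map_sub, map_smul, smul_add]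
      abel
  obtain ⟨t, z, ht, hz⟩ := key M
  have h0 : y' - of I L t = 0 := by
    refine eq_zero_of_forall_eq_pow_smul hx fun n ↦ ?_
    obtain ⟨t', z', ht', hz'⟩ := key (n + M)
    have h1 : of I L (t' - t) = x ^ M • (z - x ^ n • z') := by
      have h2 := hz.symm.trans hz'
      rw [map_sub, smul_sub, smul_smul, ← pow_add, add_comm M n, sub_eq_sub_iff_add_eq_add,
        ← h2, add_comm]
    obtain ⟨w, hw⟩ := exists_eq_smul_of_of_eq_smul (pow_mul_le_span_pow hN M) h1
    have h3 : t' - t = 0 := by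
      rw [hw]
      refine hM w ?_
      rw [pow_succ', mul_smul, ← hw, smul_sub, ht, ht', sub_self]
    rw [sub_eq_zero] at h3
    refine ⟨x ^ M • z', ?_⟩
    rw [smul_smul, ← pow_add, ← h3, hz']
    abel
  exact ⟨t + b, by rw [map_add, ← sub_eq_zero.mp h0]⟩

end PrincipalPower

section PowerSeries

variable {R : Type*} [CommRing R] {I : Ideal R} (L : Type*) [AddCommGroup L] [Module R L]
variable {x : R} {N : ℕ}

/-- The map sending a sequence `f` in `L` to the class of `∑ k < n, xᵏ fₖ` modulo `Iⁿ`. -/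
def partialSumPowSMul (I : Ideal R) (x : R) (n : ℕ) :
    (ℕ → L) →ₗ[R] L ⧸ (I ^ n • ⊤ : Submodule R L) :=
  (I ^ n • ⊤ : Submodule R L).mkQ ∘ₗ
    ∑ k ∈ Finset.range n, x ^ k • LinearMap.proj (R := R) (φ := fun _ : ℕ ↦ L) k

theorem partialSumPowSMul_apply (I : Ideal R) (x : R) (n : ℕ) (f : ℕ → L) :
    partialSumPowSMul L I x n f = Submodule.Quotient.mk (∑ k ∈ Finset.range n, x ^ k • f k) := by
  simp only [partialSumPowSMul, LinearMap.comp_apply, Submodule.mkQ_apply, LinearMap.sum_apply,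
    LinearMap.smul_apply, LinearMap.proj_apply]

theorem transitionMap_comp_partialSumPowSMul (hx : x ∈ I) {m n : ℕ} (hle : m ≤ n) :
    transitionMap I L hle ∘ₗ partialSumPowSMul L I x n = partialSumPowSMul L I x m := by
  ext1 f
  rw [LinearMap.comp_apply, partialSumPowSMul_apply, partialSumPowSMul_apply]
  change Submodule.Quotient.mk _ = _
  rw [Submodule.Quotient.eq, LinearMap.id_apply, ← Finset.sum_range_add_sum_Ico _ hle,
    add_sub_cancel_left]
  refine Submodule.sum_mem _ fun k hk ↦ ?_
  exact Submodule.smul_mem_smul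
    (Ideal.pow_le_pow_right (Finset.mem_Ico.mp hk).1 (Ideal.pow_mem_pow hx k)) trivial

/-- The map sending a sequence `f` in `L` to `∑ xⁿ fₙ` in the `I`-adic completion of `L`, where
`x ∈ I`. -/
noncomputable def sumPowSMul (hx : x ∈ I) : (ℕ → L) →ₗ[R] AdicCompletion I L :=
  lift I (partialSumPowSMul L I x) (transitionMap_comp_partialSumPowSMul L hx)

variable {L}

theorem eval_sumPowSMul (hx : x ∈ I) (f : ℕ → L) (n : ℕ) :
    eval I L n (sumPowSMul L hx f) =
      Submodule.Quotient.mk (∑ k ∈ Finset.range n, x ^ k • f k) := by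
  rw [eval_apply, sumPowSMul, eval_lift_apply, partialSumPowSMul_apply]

theorem sumPowSMul_eq_of_add_smul (hx : x ∈ I) (f : ℕ → L) :
    sumPowSMul L hx f = of I L (f 0) + x • sumPowSMul L hx (fun n ↦ f (n + 1)) := by
  suffices h : ∀ n, eval I L n (sumPowSMul L hx f) =
      eval I L n (of I L (f 0) + x • sumPowSMul L hx (fun n ↦ f (n + 1))) from
    AdicCompletion.ext h
  intro n
  rw [map_add, map_smul, eval_of, eval_sumPowSMul, eval_sumPowSMul, Submodule.mkQ_apply,
    ← Submodule.Quotient.mk_smul, ← Submodule.Quotient.mk_add, Submodule.Quotient.eq]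
  have h : f 0 + x • ∑ k ∈ Finset.range n, x ^ k • f (k + 1) =
      ∑ k ∈ Finset.range (n + 1), x ^ k • f k := by
    rw [Finset.sum_range_succ', Finset.smul_sum, add_comm]
    simp [smul_smul, pow_succ']
  rw [h, Finset.sum_range_succ, sub_add_cancel_left, neg_mem_iff]
  exact Submodule.smul_mem_smul (Ideal.pow_mem_pow hx n) trivial

theorem sumPowSMul_surjective (hI : I.FG) (hx : x ∈ I) (hN : I ^ N ≤ Ideal.span {x}) :
    Function.Surjective (sumPowSMul L hx) := by
  intro y
  choose a s h using exists_eq_of_add_smul (L := L) hI hN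
  let z : ℕ → AdicCompletion I L := fun n ↦ s^[n] y
  have hz : ∀ n, z n = of I L (a (z n)) + x • z (n + 1) := fun n ↦ by
    simp only [z, Function.iterate_succ_apply']
    exact h _
  refine ⟨fun n ↦ a (z n), ?_⟩
  have hn : ∀ n k, z k - sumPowSMul L hx (fun i ↦ a (z (i + k))) =
      x ^ n • (z (n + k) - sumPowSMul L hx (fun i ↦ a (z (i + (n + k))))) := by
    intro n
    induction n with
    | zero => simp
    | succ n ih =>
      intro k
      have h1 := hz k
      have h2 := sumPowSMul_eq_of_add_smul hx (fun i ↦ a (z (i + k)))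
      have h3 := ih (k + 1)
      rw [zero_add] at h2
      rw [h1, h2, add_sub_add_left_eq_sub, ← smul_sub]
      have e : ∀ i, i + 1 + k = i + (k + 1) := fun i ↦ by omega
      simp only [e]
      rw [h3, smul_smul, ← pow_succ']
  have := eq_zero_of_forall_eq_pow_smul hx (y := z 0 - sumPowSMul L hx (fun i ↦ a (z (i + 0))))
    fun n ↦ ⟨_, hn n 0⟩
  exact (sub_eq_zero.mp this).symm

theorem sumPowSMul_sub_smul_shift (hx : x ∈ I) (f : ℕ → L) :
    sumPowSMul L hx (fun n ↦ f n - x • f (n + 1)) = of I L (f 0) := by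
  have h : (fun n ↦ f n - x • f (n + 1)) = f - x • (fun n ↦ f (n + 1)) := rfl
  rw [h, map_sub, map_smul, sumPowSMul_eq_of_add_smul hx f, add_sub_cancel_right]

theorem sumPowSMul_mem_range_of_iff (hx : x ∈ I) [IsHausdorff I L]
    (hinj : ∀ y : AdicCompletion I L, x • y ∈ LinearMap.range (of I L) →
      y ∈ LinearMap.range (of I L)) (f : ℕ → L) :
    sumPowSMul L hx f ∈ LinearMap.range (of I L) ↔
      ∃ g : ℕ → L, ∀ n, f n = g n - x • g (n + 1) := by
  constructor
  · intro h
    have hmem : ∀ n, sumPowSMul L hx (fun i ↦ f (i + n)) ∈ LinearMap.range (of I L) := by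
      intro n
      induction n with
      | zero => exact h
      | succ n ih =>
        refine hinj _ ?_
        rw [sumPowSMul_eq_of_add_smul hx] at ih
        have h1 := Submodule.sub_mem _ ih (LinearMap.mem_range_self (of I L) (f (0 + n)))
        rw [add_sub_cancel_left] at h1
        simpa only [add_assoc, add_comm 1 n] using h1
    choose g hg using hmem
    refine ⟨g, fun n ↦ of_injective I L ?_⟩
    rw [map_sub, map_smul, hg, hg, sumPowSMul_eq_of_add_smul hx]
    simp only [zero_add, add_assoc, add_comm 1 n]
    rw [add_sub_cancel_right]
  · rintro ⟨g, hg⟩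
    rw [funext hg, sumPowSMul_sub_smul_shift]
    exact ⟨_, rfl⟩

end PowerSeries

end AdicCompletion

section Free

variable {R : Type*} [CommRing R] (L : Type*) [AddCommGroup L] [Module R L] [Module.Free R L]

theorem Module.Free.isHausdorff (I : Ideal R) [IsHausdorff I R] : IsHausdorff I L where
  haus' l hl := by
    let b := Module.Free.chooseBasis R L
    refine b.ext_elem fun i ↦ ?_
    rw [map_zero, Finsupp.zero_apply]
    refine IsHausdorff.haus ‹_› _ fun n ↦ ?_
    have h := hl n
    rw [SModEq.zero] at h ⊢
    exact (Submodule.smul_le (P := (I ^ n • ⊤ : Submodule R R).comap (b.coord i))).mpr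
      (fun r hr m _ ↦ by
        rw [Submodule.mem_comap, map_smul]
        exact Submodule.smul_mem_smul hr trivial) h

theorem Module.Free.exists_pow_smul_eq_zero [IsNoetherianRing R] (x : R) :
    ∃ M : ℕ, ∀ z : L, x ^ (M + 1) • z = 0 → x ^ M • z = 0 := by
  obtain ⟨M, hM⟩ := monotone_stabilizes_iff_noetherian.mpr (inferInstanceAs (IsNoetherian R R))
    ⟨fun n ↦ LinearMap.ker (LinearMap.lsmul R R (x ^ n)), monotone_nat_of_le_succ fun n r hr ↦ by
      simp only [LinearMap.mem_ker, LinearMap.lsmul_apply] at hr ⊢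
      rw [pow_succ', mul_smul, hr, smul_zero]⟩
  refine ⟨M, fun z hz ↦ ?_⟩
  let b := Module.Free.chooseBasis R L
  refine b.ext_elem fun i ↦ ?_
  have h : b.repr z i ∈ LinearMap.ker (LinearMap.lsmul R R (x ^ (M + 1))) := by
    rw [LinearMap.mem_ker, LinearMap.lsmul_apply, ← Finsupp.smul_apply, ← map_smul, hz]
    simp
  have h' := (hM (M + 1) (Nat.le_succ M)).symm.le h
  simpa using h'

end Free

section Telescope

variable {R : Type u} [CommRing R]

/-- The endomorphism `eₙ ↦ eₙ - x eₙ₊₁` of `R^(ℕ)`. Its cokernel is the localization of `R` away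
from `x`. -/
noncomputable def telescope (x : R) : (ℕ →₀ R) →ₗ[R] (ℕ →₀ R) :=
  Finsupp.linearCombination R fun n ↦ Finsupp.single n (1 : R) - x • Finsupp.single (n + 1) (1 : R)

@[simp]
theorem telescope_single_one (x : R) (n : ℕ) :
    telescope x (Finsupp.single n 1) = Finsupp.single n 1 - x • Finsupp.single (n + 1) 1 := by
  simp [telescope]

theorem telescope_eq (x : R) (f : ℕ →₀ R) :
    telescope x f = f - x • Finsupp.lmapDomain R R Nat.succ f := by
  have : telescope x = LinearMap.id - x • Finsupp.lmapDomain R R Nat.succ := by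
    ext n : 2
    simp [Finsupp.mapDomain_single]
  rw [this]
  rfl

theorem telescope_injective (x : R) : Function.Injective (telescope x) := by
  rw [injective_iff_map_eq_zero]
  intro f hf
  rw [telescope_eq, sub_eq_zero] at hf
  ext n
  induction n with
  | zero =>
    rw [hf, Finsupp.smul_apply, Finsupp.lmapDomain_apply, Finsupp.mapDomain_of_notMem_range]
    · simp
    · simp
  | succ n ih =>
    rw [hf, Finsupp.smul_apply, Finsupp.lmapDomain_apply,
      Finsupp.mapDomain_apply Nat.succ_injective, ih]
    simp

theorem single_sub_single_add_mem_range_telescope (x : R) (n k : ℕ) (r : R) :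
    Finsupp.single n r - Finsupp.single (n + k) (x ^ k * r) ∈ LinearMap.range (telescope x) := by
  induction k with
  | zero => simp
  | succ k ih =>
    have h : Finsupp.single (n + k) (x ^ k * r) - Finsupp.single (n + (k + 1)) (x ^ (k + 1) * r) =
        telescope x ((x ^ k * r) • Finsupp.single (n + k) 1) := by
      rw [map_smul, telescope_single_one]
      simp [smul_sub, pow_succ, add_assoc, mul_comm, mul_left_comm]
    have h' := Submodule.add_mem _ ih (LinearMap.mem_range_self (telescope x)
      ((x ^ k * r) • Finsupp.single (n + k) 1))
    rwa [← h, sub_add_sub_cancel] at h'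

theorem exists_sub_single_mem_range_telescope (x : R) (f : ℕ →₀ R) :
    ∃ (n : ℕ) (r : R), f - Finsupp.single n r ∈ LinearMap.range (telescope x) := by
  induction f using Finsupp.induction_linear with
  | zero => exact ⟨0, 0, by simp⟩
  | single n r => exact ⟨n, r, by simp⟩
  | add f g hf hg =>
    obtain ⟨n, r, h⟩ := hf
    obtain ⟨m, s, h'⟩ := hg
    refine ⟨n + m, x ^ m * r + x ^ n * s, ?_⟩
    have h1 := single_sub_single_add_mem_range_telescope x n m r
    have h2 := single_sub_single_add_mem_range_telescope x m n s
    rw [add_comm m n] at h2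
    convert Submodule.add_mem _ (Submodule.add_mem _ h h1) (Submodule.add_mem _ h' h2) using 1
    rw [Finsupp.single_add]
    abel

variable (x : R) (A : Type u) [CommRing A] [Algebra R A] [IsLocalization.Away x A]

/-- The map `R^(ℕ) → R[1/x]` sending `eₙ` to `x⁻ⁿ`. -/
noncomputable def telescopeToAway : (ℕ →₀ R) →ₗ[R] A :=
  Finsupp.linearCombination R fun n ↦ IsLocalization.Away.invSelf (S := A) x ^ n

theorem telescopeToAway_single (n : ℕ) (r : R) :
    telescopeToAway x A (Finsupp.single n r) = r • IsLocalization.Away.invSelf (S := A) x ^ n := by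
  simp [telescopeToAway]

theorem pow_smul_invSelf_pow (n : ℕ) : x ^ n • IsLocalization.Away.invSelf (S := A) x ^ n = 1 := by
  rw [Algebra.smul_def, map_pow, ← mul_pow, IsLocalization.Away.mul_invSelf, one_pow]

theorem telescopeToAway_surjective : Function.Surjective (telescopeToAway x A) := by
  intro a
  obtain ⟨n, r, h⟩ := IsLocalization.Away.surj x a
  refine ⟨Finsupp.single n r, ?_⟩
  rw [telescopeToAway_single, Algebra.smul_def, ← h, mul_assoc, ← map_pow, ← Algebra.smul_def,
    pow_smul_invSelf_pow, mul_one]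

theorem telescopeToAway_comp_telescope : telescopeToAway x A ∘ₗ telescope x = 0 := by
  ext n
  simp only [LinearMap.comp_apply, Finsupp.lsingle_apply, telescope_single_one, map_sub, map_smul,
    telescopeToAway_single, one_smul, LinearMap.zero_apply, pow_succ]
  rw [Algebra.smul_def, mul_left_comm, IsLocalization.Away.mul_invSelf, mul_one, sub_self]

theorem range_telescope_eq_ker :
    LinearMap.range (telescope x) = LinearMap.ker (telescopeToAway x A) := by
  refine le_antisymm (LinearMap.range_le_ker_iff.mpr (telescopeToAway_comp_telescope x A)) ?_
  intro f hf
  obtain ⟨n, r, h⟩ := exists_sub_single_mem_range_telescope x f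
  have h0 : telescopeToAway x A (Finsupp.single n r) = 0 := by
    have h1 := LinearMap.range_le_ker_iff.mpr (telescopeToAway_comp_telescope x A) h
    rw [LinearMap.mem_ker, map_sub, LinearMap.mem_ker.mp hf, zero_sub, neg_eq_zero] at h1
    exact h1
  have h1 : algebraMap R A r = 0 := by
    rw [← mul_one (algebraMap R A r), ← pow_smul_invSelf_pow x A n, mul_smul_comm,
      ← Algebra.smul_def, ← telescopeToAway_single, h0, smul_zero]
  obtain ⟨⟨_, k, rfl⟩, hk⟩ := (IsLocalization.map_eq_zero_iff (Submonoid.powers x) A r).mp h1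
  have h2 := single_sub_single_add_mem_range_telescope x n k r
  rw [show x ^ k * r = 0 from hk, Finsupp.single_zero, sub_zero] at h2
  simpa using Submodule.add_mem _ h h2

end Telescope

section Resolution

variable {R : Type u} [CommRing R] {P Q X : ModuleCat.{u} R}

/-- The objects of the chain complex `⋯ ⟶ 0 ⟶ Q ⟶ P`. -/
def twoTermObj (P Q : ModuleCat.{u} R) : ℕ → ModuleCat.{u} R
  | 0 => P
  | 1 => Q
  | _ + 2 => ModuleCat.of R PUnit

/-- The differentials of the chain complex `⋯ ⟶ 0 ⟶ Q ⟶ P`. -/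
def twoTermD (d : Q ⟶ P) : ∀ n, twoTermObj P Q (n + 1) ⟶ twoTermObj P Q n
  | 0 => d
  | _ + 1 => 0

/-- The chain complex `⋯ ⟶ 0 ⟶ Q ⟶ P`. -/
noncomputable def twoTermComplex (d : Q ⟶ P) : ChainComplex (ModuleCat.{u} R) ℕ :=
  ChainComplex.of (twoTermObj P Q) (twoTermD d) fun _ ↦ Limits.zero_comp

theorem twoTermComplex_d_one_zero (d : Q ⟶ P) : (twoTermComplex d).d 1 0 = d :=
  ChainComplex.of_d (twoTermObj P Q) (twoTermD d) 0

theorem twoTermComplex_d_succ (d : Q ⟶ P) (n : ℕ) : (twoTermComplex d).d (n + 2) (n + 1) = 0 :=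
  ChainComplex.of_d ..

theorem isZero_twoTermComplex_X (d : Q ⟶ P) (n : ℕ) :
    Limits.IsZero ((twoTermComplex d).X (n + 2)) :=
  ModuleCat.isZero_of_subsingleton (ModuleCat.of R PUnit)

theorem twoTermComplex_exactAt_succ (d : Q ⟶ P) [Mono d] (n : ℕ) :
    (twoTermComplex d).ExactAt (n + 1) := by
  rw [HomologicalComplex.exactAt_iff' _ (n + 2) (n + 1) n (by simp) (by simp)]
  cases n with
  | zero =>
    have : Mono ((twoTermComplex d).sc' 2 1 0).g := by
      change Mono ((twoTermComplex d).d 1 0)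
      rw [twoTermComplex_d_one_zero]
      exact ‹Mono d›
    exact (ShortComplex.exact_iff_mono _ (twoTermComplex_d_succ d 0)).mpr this
  | succ n => exact ShortComplex.exact_of_isZero_X₂ _ (isZero_twoTermComplex_X d n)

/-- The projective resolution `0 ⟶ Q ⟶ P ⟶ X` given by a short exact sequence. -/
noncomputable def twoTermResolution [Projective P] [Projective Q] (d : Q ⟶ P) (e : P ⟶ X)
    (w : d ≫ e = 0) (h : (ShortComplex.mk d e w).ShortExact) : ProjectiveResolution X where
  complex := twoTermComplex d
  projective
    | 0 => inferInstanceAs (Projective P)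
    | 1 => inferInstanceAs (Projective Q)
    | n + 2 => (isZero_twoTermComplex_X d n).projective
  π := (ChainComplex.toSingle₀Equiv _ _).symm ⟨e, by
    rw [twoTermComplex_d_one_zero]
    exact w⟩
  quasiIso := ⟨fun n => by
    have : Mono d := h.mono_f
    cases n
    · rw [ChainComplex.quasiIsoAt₀_iff, ShortComplex.quasiIso_iff_of_zeros']
      · refine (ShortComplex.exact_and_epi_g_iff_of_iso ?_).2 ⟨h.exact, h.epi_g⟩
        exact ShortComplex.isoMk (Iso.refl _) (Iso.refl _) (Iso.refl _)
          ((Category.id_comp _).trans ((twoTermComplex_d_one_zero d).symm.trans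
            (Category.comp_id _).symm))
          ((Category.id_comp _).trans
            ((ChainComplex.toSingle₀Equiv_symm_apply_f_zero (C := twoTermComplex d) e
              ((congrArg (· ≫ e) (twoTermComplex_d_one_zero d)).trans w)).symm.trans
              (Category.comp_id _).symm))
      all_goals rfl
    · rw [quasiIsoAt_iff_exactAt']
      · apply twoTermComplex_exactAt_succ
      · apply ChainComplex.exactAt_succ_single_obj⟩

/-- `Ext¹(X, Y)` is the cokernel of `Hom(P, Y) → Hom(Q, Y)` when `0 ⟶ Q ⟶ P ⟶ X ⟶ 0` is exact and
`P`, `Q` are projective. -/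
theorem nonempty_extOne_iso [Projective P] [Projective Q] (d : Q ⟶ P) (e : P ⟶ X)
    (w : d ≫ e = 0) (h : (ShortComplex.mk d e w).ShortExact) (Y : ModuleCat.{u} R)
    {C : Type u} [AddCommGroup C] [Module R C] (ψ : (Q ⟶ Y) →ₗ[R] C)
    (hψ : Function.Surjective ψ)
    (hker : ∀ f : Q ⟶ Y, ψ f = 0 ↔ ∃ g : P ⟶ Y, d ≫ g = f) :
    Nonempty (C ≃ₗ[R] (((Ext R (ModuleCat.{u} R) 1).obj (Opposite.op X)).obj Y)) := by
  let K := (twoTermComplex d).linearYonedaObj R Y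
  have hd : K.d 1 2 = 0 := by
    ext f
    exact (isZero_twoTermComplex_X d 0).eq_of_src _ _
  let ψ' : K.X 1 ⟶ ModuleCat.of R C := ModuleCat.ofHom ψ
  let S : ShortComplex (ModuleCat.{u} R) := ShortComplex.mk (K.d 0 1) ψ' (by
    ext g
    refine (hker _).mpr ⟨g, ?_⟩
    rw [← twoTermComplex_d_one_zero d]
    rfl)
  have : Epi S.g := (ModuleCat.epi_iff_surjective _).mpr hψ
  have hS : S.Exact := by
    rw [ShortComplex.moduleCat_exact_iff]
    intro f hf
    obtain ⟨g, hg⟩ := (hker f).mp hf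
    refine ⟨g, ?_⟩
    rw [← twoTermComplex_d_one_zero d] at hg
    exact hg
  exact ⟨((twoTermResolution d e w h).isoExt 1 Y ≪≫
    K.isoHomologyι 1 2 (by simp) hd ≪≫
    (K.opcyclesIsCokernel 0 1 (by simp)).coconePointUniqueUpToIso hS.gIsCokernel).symm
      |>.toLinearEquiv⟩

end Resolution

section LocalizationAtPrime

variable {R : Type u} [CommRing R] [IsNoetherianRing R] [IsLocalRing R]
  {p : Ideal R} [p.IsPrime]

theorem exists_maximalIdeal_pow_le_span
    (hspec : ∀ q : Ideal R, q.IsPrime → q = p ∨ q = IsLocalRing.maximalIdeal R)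
    {x : R} (hx : x ∉ p) : ∃ N, IsLocalRing.maximalIdeal R ^ N ≤ Ideal.span {x} := by
  refine Ideal.exists_pow_le_of_le_radical_of_fg ?_ (IsNoetherian.noetherian _)
  rw [Ideal.radical_eq_sInf]
  refine le_sInf fun q ⟨hq, hq'⟩ ↦ ?_
  rcases hspec q hq' with rfl | rfl
  · exact absurd (hq (Ideal.mem_span_singleton_self x)) hx
  · exact le_rfl

theorem isLocalizationAway_localizationAtPrime
    (hspec : ∀ q : Ideal R, q.IsPrime → q = p ∨ q = IsLocalRing.maximalIdeal R)
    {x : R} (hx : x ∉ p) (hxm : x ∈ IsLocalRing.maximalIdeal R) :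
    IsLocalization.Away x (Localization.AtPrime p) := by
  have : IsLocalization p.primeCompl (Localization.Away x) := by
    refine IsLocalization.of_le_of_exists_dvd (Submonoid.powers x) _
      (Submonoid.powers_le.mpr hx) fun s hs ↦ ?_
    obtain ⟨N, hN⟩ := exists_maximalIdeal_pow_le_span hspec hs
    exact ⟨x ^ N, ⟨N, rfl⟩, Ideal.mem_span_singleton.mp (hN (Ideal.pow_mem_pow hxm N))⟩
  exact IsLocalization.isLocalization_of_algEquiv (Submonoid.powers x)
    (IsLocalization.algEquiv p.primeCompl (Localization.Away x) (Localization.AtPrime p))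

end LocalizationAtPrime

/-- An `R`-module on which all elements of `S` act bijectively is a module over the localization
of `R` at `S`. -/
theorem exists_module_localization_of_bijective {R : Type*} [CommRing R] (S : Submonoid R)
    {M : Type*} [AddCommGroup M] [Module R M]
    (h : ∀ s ∈ S, Function.Bijective fun m : M ↦ s • m) :
    ∃ inst : Module (Localization S) M, ∀ (r : R) (m : M),
      (letI := inst; (algebraMap R (Localization S) r) • m) = r • m := by
  have : IsLocalizedModule S (LinearMap.id : M →ₗ[R] M) :=
    { map_units s := (Module.End.isUnit_iff _).mpr (h s s.2)
      surj m := ⟨(m, 1), one_smul _ _⟩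
      exists_of_eq := fun h ↦ ⟨1, by simpa using h⟩ }
  let e := (IsLocalizedModule.iso S (LinearMap.id : M →ₗ[R] M)).symm
  refine ⟨e.toAddEquiv.module (Localization S), fun r m ↦ ?_⟩
  change e.symm (algebraMap R (Localization S) r • e m) = r • m
  rw [algebraMap_smul, map_smul, e.symm_apply_apply]

/-- Let `R` be a commutative noetherian ring whose spectrum is `{𝔪, 𝔭}`
with `𝔭 ⊊ 𝔪` and `𝔪` the maximal ideal. Let `L` be a free `R`-module with `𝔪`-adic
completion `L̂`, and `L' = L̂/L`. Then `L'` carries an `R_𝔭`-module structure compatible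
with its `R`-module structure, and `L' ≅ Ext¹_R(R_𝔭, L)` as `R`-modules. -/
theorem quotient_of_completion_is_localization_module_and_ext
    {R : Type u} [CommRing R] [IsNoetherianRing R] [IsLocalRing R]
    (p : Ideal R) [p.IsPrime] (hlt : p < IsLocalRing.maximalIdeal R)
    (hspec : ∀ q : Ideal R, q.IsPrime → q = p ∨ q = IsLocalRing.maximalIdeal R)
    (L : Type u) [AddCommGroup L] [Module R L] [Module.Free R L] :
    (∃ inst : Module (Localization.AtPrime p)
        (AdicCompletion (IsLocalRing.maximalIdeal R) L ⧸
          LinearMap.range (AdicCompletion.of (IsLocalRing.maximalIdeal R) L)),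
      ∀ (r : R) (x : AdicCompletion (IsLocalRing.maximalIdeal R) L ⧸
          LinearMap.range (AdicCompletion.of (IsLocalRing.maximalIdeal R) L)),
        (letI := inst; (algebraMap R (Localization.AtPrime p) r) • x) = r • x) ∧
    Nonempty
      ((AdicCompletion (IsLocalRing.maximalIdeal R) L ⧸
          LinearMap.range (AdicCompletion.of (IsLocalRing.maximalIdeal R) L)) ≃ₗ[R]
        (((Ext R (ModuleCat.{u} R) 1).obj
            (Opposite.op (ModuleCat.of R (Localization.AtPrime p)))).obj
          (ModuleCat.of R L))) := by
  have hfg : (IsLocalRing.maximalIdeal R).FG := IsNoetherian.noetherian _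
  have : IsHausdorff (IsLocalRing.maximalIdeal R) L := Module.Free.isHausdorff L _
  have hinj : ∀ s ∈ IsLocalRing.maximalIdeal R, s ∉ p →
      ∀ y : AdicCompletion (IsLocalRing.maximalIdeal R) L,
        s • y ∈ LinearMap.range (AdicCompletion.of (IsLocalRing.maximalIdeal R) L) →
        y ∈ LinearMap.range (AdicCompletion.of (IsLocalRing.maximalIdeal R) L) := by
    intro s hs hsp y hy
    obtain ⟨N, hN⟩ := exists_maximalIdeal_pow_le_span hspec hsp
    obtain ⟨M, hM⟩ := Module.Free.exists_pow_smul_eq_zero L s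
    exact AdicCompletion.mem_range_of_of_smul_mem hfg hs hN hM hy
  refine ⟨exists_module_localization_of_bijective p.primeCompl fun s hs ↦ ?_, ?_⟩
  · by_cases hsm : s ∈ IsLocalRing.maximalIdeal R
    · constructor
      · refine (injective_iff_map_eq_zero (DistribSMul.toAddMonoidHom _ s)).mpr fun q hq ↦ ?_
        obtain ⟨y, rfl⟩ := Submodule.Quotient.mk_surjective _ q
        rw [Submodule.Quotient.mk_eq_zero]
        exact hinj s hsm hs y ((Submodule.Quotient.mk_eq_zero _).mp hq)
      · intro q
        obtain ⟨y, rfl⟩ := Submodule.Quotient.mk_surjective _ q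
        obtain ⟨N, hN⟩ := exists_maximalIdeal_pow_le_span hspec hs
        obtain ⟨a, z, rfl⟩ := AdicCompletion.exists_eq_of_add_smul hfg hN y
        refine ⟨Submodule.Quotient.mk z, ?_⟩
        change Submodule.Quotient.mk (s • z) = _
        rw [Submodule.Quotient.eq, sub_add_cancel_right, neg_mem_iff]
        exact LinearMap.mem_range_self _ a
    · exact (IsLocalRing.notMem_maximalIdeal.mp hsm).smul_bijective
  · obtain ⟨x, hx, hxp⟩ := SetLike.exists_of_lt hlt
    obtain ⟨N, hN⟩ := exists_maximalIdeal_pow_le_span hspec hxp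
    have := isLocalizationAway_localizationAtPrime hspec hxp hx
    let F := ModuleCat.of R (ℕ →₀ R)
    let A := ModuleCat.of R (Localization.AtPrime p)
    let d : F ⟶ F := ModuleCat.ofHom (telescope x)
    let e : F ⟶ A := ModuleCat.ofHom (telescopeToAway x (Localization.AtPrime p))
    have w : d ≫ e = 0 := by
      ext1
      exact telescopeToAway_comp_telescope x _
    have : Projective F := ModuleCat.projective_of_free (Finsupp.basisSingleOne (R := R) (ι := ℕ))
    have hmono : Mono d := (ModuleCat.mono_iff_injective _).mpr (telescope_injective x)
    have hepi : Epi e := (ModuleCat.epi_iff_surjective _).mpr (telescopeToAway_surjective x _)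
    have hexact : (ShortComplex.mk d e w).Exact :=
      (ShortComplex.moduleCat_exact_iff_range_eq_ker _).mpr (range_telescope_eq_ker x _)
    let E : (F ⟶ ModuleCat.of R L) ≃ₗ[R] (ℕ → L) :=
      ModuleCat.homLinearEquiv.trans
        ((Finsupp.lsum R).symm.trans (LinearEquiv.piCongrRight fun _ ↦
          LinearMap.ringLmapEquivSelf R R L))
    have hE : ∀ f n, E f n = f (Finsupp.single n 1) := fun f n ↦ rfl
    refine nonempty_extOne_iso d e w (ShortComplex.ShortExact.mk' hexact hmono hepi) _
      (Submodule.mkQ _ ∘ₗ AdicCompletion.sumPowSMul L hx ∘ₗ E.toLinearMap) ?_ fun f ↦ ?_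
    · exact (Submodule.mkQ_surjective _).comp
        ((AdicCompletion.sumPowSMul_surjective hfg hx hN).comp E.surjective)
    · refine (Submodule.Quotient.mk_eq_zero _).trans
        ((AdicCompletion.sumPowSMul_mem_range_of_iff hx (hinj x hx hxp) _).trans ?_)
      refine E.surjective.exists.trans (exists_congr fun g ↦ ?_)
      have hd : ∀ n, E (d ≫ g) n = E g n - x • E g (n + 1) := fun n ↦ by
        rw [hE, hE, hE, ← map_smul, ← map_sub, ← telescope_single_one]
        rfl
      simp only [← hd]
      rw [← E.injective.eq_iff, funext_iff]
      exact forall_congr' fun n ↦ eq_comm
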